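/- arXiv:2205.08644 — 2 statements merged into one kernel-verified Lean document; each statement's English description precedes it below -/
import Mathlib

section
/- Under the pre-post linear DiD model, the expected naïve difference-in-differences estimator E[τ̂_DiD] = {E(Y₁|Z=1) − E(Y₁|Z=0)} − {E(Y₀|Z=1) − E(Y₀|Z=0)} satisfies E[τ̂_DiD] − τ̄ = Δθ·δθ + Δx·δx, where τ̄ = E[τ | Z=1] is the ATT. -/
open MeasureTheory ProbabilityTheory

/-- A measure `ν` on `ℝ × ℝ` is bivariate Gaussian with means `m₁, m₂`, variances `v₁, v₂` and
covariance `c` iff every linear functional pushes it forward to the appropriate real Gaussian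
(Cramér–Wold characterization). -/
def IsBivarGaussian (ν : Measure (ℝ × ℝ)) (m₁ m₂ v₁ c v₂ : ℝ) : Prop :=
  ∀ a b : ℝ,
    ν.map (fun w => a * w.1 + b * w.2) =
      gaussianReal (a * m₁ + b * m₂)
        (Real.toNNReal (a ^ 2 * v₁ + 2 * a * b * c + b ^ 2 * v₂))

/-- Conditioning on an event of one of two independent random variables does not change the law of
the other. -/
theorem ProbabilityTheory.IndepFun.map_cond_preimage_eq {Ω α β : Type*} [MeasurableSpace Ω]
    [MeasurableSpace α] [MeasurableSpace β] {μ : Measure Ω} [IsFiniteMeasure μ]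
    {f : Ω → α} {g : Ω → β} (h : IndepFun f g μ) (hf : Measurable f) (hg : Measurable g)
    {t : Set β} (ht : MeasurableSet t) (h0 : μ (g ⁻¹' t) ≠ 0) :
    (ProbabilityTheory.cond μ (g ⁻¹' t)).map f = μ.map f := by
  ext A hA
  rw [Measure.map_apply hf hA, Measure.map_apply hf hA, cond_apply (hg ht), Set.inter_comm,
    h.measure_inter_preimage_eq_mul _ _ hA ht, mul_comm (μ (f ⁻¹' A)), ← mul_assoc,
    ENNReal.inv_mul_cancel h0 (measure_ne_top μ _), one_mul]

/-- A random variable with a real Gaussian law is integrable. -/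
theorem integrable_of_map_eq_gaussianReal {Ω : Type*} [MeasurableSpace Ω] {P : Measure Ω}
    {f : Ω → ℝ} (hf : Measurable f) {m : ℝ} {v : NNReal} (h : P.map f = gaussianReal m v) :
    Integrable f P := by
  have hid : Integrable (id : ℝ → ℝ) (P.map f) := by
    rw [h]
    exact (memLp_id_gaussianReal 1).integrable le_rfl
  exact hid.comp_measurable hf

/-- The expectation of a random variable with a real Gaussian law is the mean parameter. -/
theorem integral_of_map_eq_gaussianReal {Ω : Type*} [MeasurableSpace Ω] {P : Measure Ω}
    {f : Ω → ℝ} (hf : Measurable f) {m : ℝ} {v : NNReal} (h : P.map f = gaussianReal m v) :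
    ∫ ω, f ω ∂P = m := by
  have hmap := integral_map (μ := P) hf.aemeasurable (f := (id : ℝ → ℝ))
    measurable_id.aestronglyMeasurable
  rw [h] at hmap
  simpa [integral_id_gaussianReal] using hmap.symm

/-- A linear functional of a pair with bivariate Gaussian law is Gaussian. -/
theorem IsBivarGaussian.map_linear {Ω : Type*} [MeasurableSpace Ω] {P : Measure Ω}
    {θ X : Ω → ℝ} (hθ : Measurable θ) (hX : Measurable X) {m₁ m₂ v₁ c v₂ : ℝ}
    (h : IsBivarGaussian (P.map (fun ω => (θ ω, X ω))) m₁ m₂ v₁ c v₂) (a b : ℝ) :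
    P.map (fun ω => a * θ ω + b * X ω) =
      gaussianReal (a * m₁ + b * m₂)
        (Real.toNNReal (a ^ 2 * v₁ + 2 * a * b * c + b ^ 2 * v₂)) := by
  rw [← h a b, Measure.map_map (by fun_prop) (by fun_prop)]
  rfl

/-- The expectation of a linear outcome with Gaussian covariates, centred Gaussian noise and an
integrable additional effect. -/
theorem integral_linear_outcome {Ω : Type*} [MeasurableSpace Ω] {P : Measure Ω}
    [IsProbabilityMeasure P] {θ X ε η : Ω → ℝ} (hθ : Measurable θ) (hX : Measurable X)
    (hε : Measurable ε) {m₁ m₂ v₁ c v₂ : ℝ} {v : NNReal}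
    (hG : IsBivarGaussian (P.map (fun ω => (θ ω, X ω))) m₁ m₂ v₁ c v₂)
    (hεlaw : P.map ε = gaussianReal 0 v) (hη : Integrable η P) (b₀ b₁ b₂ : ℝ) :
    ∫ ω, (b₀ + b₁ * θ ω + b₂ * X ω + ε ω + η ω) ∂P =
      b₀ + b₁ * m₁ + b₂ * m₂ + ∫ ω, η ω ∂P := by
  have hlin := hG.map_linear hθ hX b₁ b₂
  have hmeas : Measurable (fun ω => b₁ * θ ω + b₂ * X ω) := by fun_prop
  have hi := integrable_of_map_eq_gaussianReal hmeas hlin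
  have hiε := integrable_of_map_eq_gaussianReal hε hεlaw
  have hib : Integrable (fun ω => b₀ + (b₁ * θ ω + b₂ * X ω)) P := (integrable_const b₀).add hi
  have hibε : Integrable (fun ω => b₀ + (b₁ * θ ω + b₂ * X ω) + ε ω) P := hib.add hiε
  calc ∫ ω, (b₀ + b₁ * θ ω + b₂ * X ω + ε ω + η ω) ∂P
      = ∫ ω, (((b₀ + (b₁ * θ ω + b₂ * X ω)) + ε ω) + η ω) ∂P := by simp only [add_assoc]
    _ = b₀ + (b₁ * m₁ + b₂ * m₂) + 0 + ∫ ω, η ω ∂P := by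
      rw [integral_add hibε hη, integral_add hib hiε,
        integral_add (integrable_const b₀) hi, integral_of_map_eq_gaussianReal hmeas hlin,
        integral_of_map_eq_gaussianReal hε hεlaw]
      simp
    _ = _ := by ring

/-- Under the pre-post linear DiD model, the bias of the naïve
difference-in-differences estimator is `Δθ δθ + Δx δx`. -/
theorem bias_naiveDiD
    {Ω : Type*} [MeasurableSpace Ω] (μ : Measure Ω) [IsProbabilityMeasure μ]
    (Z θ X ε₀ ε₁ τ Y₀ Y₁ : Ω → ℝ)
    (p μθ₀ μθ₁ μx₀ μx₁ σθ σx ρ σE : ℝ)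
    (β₀₀ β₀₁ βθ₀ βθ₁ βx₀ βx₁ : ℝ)
    (hZ : Measurable Z) (hθ : Measurable θ) (hX : Measurable X)
    (hε₀ : Measurable ε₀) (hε₁ : Measurable ε₁) (hτm : Measurable τ)
    (hτint : Integrable τ μ)
    (hZ01 : ∀ ω, Z ω = 0 ∨ Z ω = 1)
    (hp : μ {ω | Z ω = 1} = ENNReal.ofReal p) (hp0 : 0 < p) (hp1 : p < 1)
    (hσθ : 0 < σθ) (hσx : 0 < σx) (hρ : -1 < ρ) (hρ' : ρ < 1) (hσE : 0 < σE)
    (hG0 : IsBivarGaussian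
      ((ProbabilityTheory.cond μ {ω | Z ω = 0}).map (fun ω => (θ ω, X ω)))
      μθ₀ μx₀ (σθ ^ 2) (ρ * σθ * σx) (σx ^ 2))
    (hG1 : IsBivarGaussian
      ((ProbabilityTheory.cond μ {ω | Z ω = 1}).map (fun ω => (θ ω, X ω)))
      μθ₁ μx₁ (σθ ^ 2) (ρ * σθ * σx) (σx ^ 2))
    (hεlaw₀ : μ.map ε₀ = gaussianReal 0 (Real.toNNReal (σE ^ 2)))
    (hεlaw₁ : μ.map ε₁ = gaussianReal 0 (Real.toNNReal (σE ^ 2)))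
    (hεindep : IndepFun ε₀ ε₁ μ)
    (hεW : IndepFun (fun ω => (ε₀ ω, ε₁ ω)) (fun ω => (θ ω, X ω, Z ω, τ ω)) μ)
    (hY₀ : ∀ ω, Y₀ ω = β₀₀ + βθ₀ * θ ω + βx₀ * X ω + ε₀ ω)
    (hY₁ : ∀ ω, Y₁ ω = β₀₁ + βθ₁ * θ ω + βx₁ * X ω + ε₁ ω + Z ω * τ ω)
    :
    ((∫ ω, Y₁ ω ∂(ProbabilityTheory.cond μ {ω | Z ω = 1}))
        - (∫ ω, Y₁ ω ∂(ProbabilityTheory.cond μ {ω | Z ω = 0})))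
      - ((∫ ω, Y₀ ω ∂(ProbabilityTheory.cond μ {ω | Z ω = 1}))
        - (∫ ω, Y₀ ω ∂(ProbabilityTheory.cond μ {ω | Z ω = 0})))
      - (∫ ω, τ ω ∂(ProbabilityTheory.cond μ {ω | Z ω = 1}))
      = (βθ₁ - βθ₀) * (μθ₁ - μθ₀) + (βx₁ - βx₀) * (μx₁ - μx₀) := by
  have hm (z : ℝ) : MeasurableSet {ω | Z ω = z} := hZ (measurableSet_singleton z)
  have hpos1 : μ {ω | Z ω = 1} ≠ 0 := by
    rw [hp]
    exact (ENNReal.ofReal_pos.2 hp0).ne'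
  have hpos0 : μ {ω | Z ω = 0} ≠ 0 := by
    intro h0
    have hcompl : {ω | Z ω = 0}ᶜ = {ω | Z ω = 1} := by
      ext ω
      rcases hZ01 ω with h | h <;> simp [h]
    have hone := prob_compl_eq_one_sub (μ := μ) (hm 0)
    rw [hcompl, hp, h0, tsub_zero] at hone
    exact hp1.ne (ENNReal.ofReal_eq_one.1 hone)
  have hZind₀ : IndepFun ε₀ Z μ :=
    hεW.comp measurable_fst (measurable_fst.comp (measurable_snd.comp measurable_snd))
  have hZind₁ : IndepFun ε₁ Z μ :=
    hεW.comp measurable_snd (measurable_fst.comp (measurable_snd.comp measurable_snd))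
  have hlaw₀ (z : ℝ) (hz : μ {ω | Z ω = z} ≠ 0) :
      (ProbabilityTheory.cond μ {ω | Z ω = z}).map ε₀ =
        gaussianReal 0 (Real.toNNReal (σE ^ 2)) :=
    (hZind₀.map_cond_preimage_eq hε₀ hZ (measurableSet_singleton z) hz).trans hεlaw₀
  have hlaw₁ (z : ℝ) (hz : μ {ω | Z ω = z} ≠ 0) :
      (ProbabilityTheory.cond μ {ω | Z ω = z}).map ε₁ =
        gaussianReal 0 (Real.toNNReal (σE ^ 2)) :=
    (hZind₁.map_cond_preimage_eq hε₁ hZ (measurableSet_singleton z) hz).trans hεlaw₁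
  have := cond_isProbabilityMeasure hpos0
  have := cond_isProbabilityMeasure hpos1
  have hτ1 : Integrable τ (ProbabilityTheory.cond μ {ω | Z ω = 1}) :=
    hτint.restrict.smul_measure (ENNReal.inv_ne_top.2 hpos1)
  have hZτ1 : (fun ω => Z ω * τ ω) =ᵐ[ProbabilityTheory.cond μ {ω | Z ω = 1}] τ := by
    filter_upwards [ae_cond_mem (hm 1)] with ω hω
    rw [show Z ω = 1 from hω, one_mul]
  have hZτ0 : (fun ω => Z ω * τ ω) =ᵐ[ProbabilityTheory.cond μ {ω | Z ω = 0}] fun _ => 0 := by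
    filter_upwards [ae_cond_mem (hm 0)] with ω hω
    rw [show Z ω = 0 from hω, zero_mul]
  have e11 := integral_linear_outcome hθ hX hε₁ hG1 (hlaw₁ 1 hpos1)
    (hτ1.congr hZτ1.symm) β₀₁ βθ₁ βx₁
  have e10 := integral_linear_outcome hθ hX hε₁ hG0 (hlaw₁ 0 hpos0)
    ((integrable_zero _ _ _).congr hZτ0.symm) β₀₁ βθ₁ βx₁
  have e01 := integral_linear_outcome hθ hX hε₀ hG1 (hlaw₀ 1 hpos1)
    (integrable_zero _ ℝ _) β₀₀ βθ₀ βx₀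
  have e00 := integral_linear_outcome hθ hX hε₀ hG0 (hlaw₀ 0 hpos0)
    (integrable_zero _ ℝ _) β₀₀ βθ₀ βx₀
  rw [integral_congr_ae hZτ1] at e11
  rw [integral_congr_ae hZτ0] at e10
  simp only [Pi.zero_apply, add_zero, integral_zero] at e10 e01 e00
  simp only [hY₀, hY₁]
  rw [e11, e10, e01, e00]
  ring
end

section
/- Under the multi-period linear DiD model with a single latent confounder (q = 1), suppose the three sign conditions hold: (1) sign(Δ⃗xᵀδ⃗x) = sign(Δθ·δθ), (2) sign(Δθ·ΣθX ΣXX⁻¹ δ⃗x) = sign(Δθ·δθ), and (3) sign(δθ) = sign(δθ − ΣθX ΣXX⁻¹ δ⃗x), where sign takes values in {−1, 0, 1}. Then matching on X weakly reduces absolute bias relative to the naïve generalized DiD: |Δθ·δθ + Δ⃗xᵀδ⃗x| ≥ |Δθ·(δθ − ΣθX ΣXX⁻¹ δ⃗x)|, i.e. |E[τ̂_gDiD] − τ̄| ≥ |E[τ̂^X_gDiD] − τ̄|. -/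
open Matrix

theorem Real.sign_mul_eq_sign_mul_sign (x y : ℝ) :
    Real.sign (x * y) = Real.sign x * Real.sign y := by
  rcases lt_trichotomy x 0 with hx | rfl | hx <;> rcases lt_trichotomy y 0 with hy | rfl | hy <;>
    simp [Real.sign_of_neg, Real.sign_of_pos, mul_pos_of_neg_of_neg, mul_neg_of_neg_of_pos,
      mul_neg_of_pos_of_neg, *]

theorem Real.sign_eq_one_iff_pos {x : ℝ} : Real.sign x = 1 ↔ 0 < x := by
  rcases lt_trichotomy x 0 with hx | rfl | hx
  · simp only [Real.sign_of_neg hx, hx.not_gt, iff_false]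
    norm_num
  · simp
  · simp [Real.sign_of_pos hx, hx]

theorem Real.sign_eq_neg_one_iff_neg {x : ℝ} : Real.sign x = -1 ↔ x < 0 := by
  rw [← neg_pos, ← Real.sign_eq_one_iff_pos, Real.sign_neg, neg_eq_iff_eq_neg]

theorem abs_sub_le_abs_add_of_sign_eq {a b c : ℝ} (hb : Real.sign b = Real.sign a)
    (hc : Real.sign c = Real.sign a) (hac : Real.sign a = Real.sign (a - c)) :
    |a - c| ≤ |a + b| := by
  rcases lt_trichotomy a 0 with ha | rfl | ha
  · rw [Real.sign_of_neg ha, Real.sign_eq_neg_one_iff_neg] at hb hc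
    rw [Real.sign_of_neg ha, eq_comm, Real.sign_eq_neg_one_iff_neg] at hac
    rw [abs_of_neg hac, abs_of_neg (add_neg ha hb)]
    linarith
  · rw [Real.sign_zero, Real.sign_eq_zero_iff] at hc
    simp [hc]
  · rw [Real.sign_of_pos ha, Real.sign_eq_one_iff_pos] at hb hc
    rw [Real.sign_of_pos ha, eq_comm, Real.sign_eq_one_iff_pos] at hac
    rw [abs_of_pos hac, abs_of_pos (add_pos ha hb)]
    linarith

/-- (Single latent confounder.)  Under the three sign conditions
(1) `sign(Δ⃗xᵀδ⃗x) = sign(Δθ δθ)`, (2) `sign(Δθ ΣθX ΣXX⁻¹ δ⃗x) = sign(Δθ δθ)` and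
(3) `sign(δθ) = sign(δθ - ΣθX ΣXX⁻¹ δ⃗x)`, matching on `X` weakly reduces absolute bias relative
to the naïve generalized DiD:
`|Δθ δθ + Δ⃗xᵀδ⃗x| ≥ |Δθ (δθ - ΣθX ΣXX⁻¹ δ⃗x)|`. -/
theorem matchX_reduces_bias_of_signs {d : ℕ}
    (Δθ δθ : ℝ) (Δx δx SθX : Fin d → ℝ) (SXX : Matrix (Fin d) (Fin d) ℝ)
    (hSXX : SXX.PosDef)
    (hsign1 : Real.sign (Δx ⬝ᵥ δx) = Real.sign (Δθ * δθ))
    (hsign2 : Real.sign (Δθ * ((Matrix.vecMul SθX SXX⁻¹) ⬝ᵥ δx)) = Real.sign (Δθ * δθ))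
    (hsign3 : Real.sign δθ = Real.sign (δθ - (Matrix.vecMul SθX SXX⁻¹) ⬝ᵥ δx)) :
    |Δθ * (δθ - (Matrix.vecMul SθX SXX⁻¹) ⬝ᵥ δx)| ≤ |Δθ * δθ + Δx ⬝ᵥ δx| := by
  rw [mul_sub]
  refine abs_sub_le_abs_add_of_sign_eq hsign1 hsign2 ?_
  rw [← mul_sub, Real.sign_mul_eq_sign_mul_sign, Real.sign_mul_eq_sign_mul_sign, hsign3]
end
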